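/- For every positive integer n, pf_{χ_even(n) ≤ i < j ≤ n}(a_{ij}) = ∏_{1 ≤ i < j ≤ n} ((x_j - x_i)(1 + x_i x_j))/((x_i + x_j)(1 - x_i x_j)), where a_{0j} = 1 and a_{ij} = ((x_j - x_i)(1 + x_i x_j))/((x_i + x_j)(1 - x_i x_j)) for i ≥ 1. -/

import Mathlib

noncomputable section

/-- The field of rational functions `ℚ(x_0, x_1, x_2, …)`. -/
abbrev KK : Type := FractionRing (MvPolynomial ℕ ℚ)

/-- The indeterminates `x_i`. -/
def xx (i : ℕ) : KK := algebraMap (MvPolynomial ℕ ℚ) KK (MvPolynomial.X i)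

/-- The Pfaffian of a `2m × 2m` matrix (intended to be skew-symmetric), via the
permutation-sum formula. -/
def pfaffian {K : Type*} [Field K] {m : ℕ}
    (A : Matrix (Fin (2 * m)) (Fin (2 * m)) K) : K :=
  (∑ σ : Equiv.Perm (Fin (2 * m)), ((Equiv.Perm.sign σ : ℤ) : K) *
      ∏ i : Fin m, A (σ ⟨2 * i.val, by omega⟩) (σ ⟨2 * i.val + 1, by omega⟩)) /
    ((2 ^ m * Nat.factorial m : ℕ) : K)

/-- The label of the `p`-th row/column of the triangular array indexed by
`χ_even(n) ≤ i < j ≤ n`: the labels are `1,…,n` for even `n` and `0,…,n` for odd `n`. -/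
def lab (n p : ℕ) : ℕ := if Even n then p + 1 else p

/-- The skew-symmetric completion of the triangular array `(a i j)_{χ_even(n) ≤ i < j ≤ n}`;
its size `2⌈n/2⌉` is even in both cases. -/
def pfArray (n : ℕ) (a : ℕ → ℕ → KK) :
    Matrix (Fin (2 * ((n + 1) / 2))) (Fin (2 * ((n + 1) / 2))) KK :=
  fun i j =>
    if lab n i < lab n j then a (lab n i) (lab n j)
    else if lab n j < lab n i then -(a (lab n j) (lab n i)) else 0


open Finset

def QQ {κ K : Type*} [Fintype κ] [DecidableEq κ] [Field K] (A : κ × Fin 2 → κ × Fin 2 → K) : K :=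
  ∑ σ : Equiv.Perm (κ × Fin 2), ((Equiv.Perm.sign σ : ℤ) : K) * ∏ k, A (σ (k,0)) (σ (k,1))

theorem QQ_congr {κ K : Type*} [Fintype κ] [DecidableEq κ] [Field K]
    (A B : Matrix (κ × Fin 2) (κ × Fin 2) K) :
    QQ (fun i j => ∑ p : (κ × Fin 2) × (κ × Fin 2), B i p.1 * A p.1 p.2 * B j p.2) = B.det * QQ A := by
  unfold QQ
  simp_rw [Fintype.prod_sum, Finset.mul_sum]
  rw [Finset.sum_comm]
  have e : ∀ g : κ → (κ × Fin 2) × (κ × Fin 2), 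
    ∑ σ : Equiv.Perm (κ × Fin 2), ((Equiv.Perm.sign σ : ℤ) : K) * ∏ k, (B (σ (k,0)) (g k).1 * A (g k).1 (g k).2 * B (σ (k,1)) (g k).2) = 
     (∏ k, A (g k).1 (g k).2) * (B.submatrix id (fun p : κ × Fin 2 => if p.2 = 0 then (g p.1).1 else (g p.1).2)).det := by
    intro g
    rw [Matrix.det_apply', Finset.mul_sum]
    refine Finset.sum_congr rfl fun σ _ => ?_
    rw [Fintype.prod_prod_type]
    simp only [Finset.prod_mul_distrib, Fin.prod_univ_two, Matrix.submatrix_apply, id]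
    simp
    ring
  simp_rw [e]
  symm
  apply Fintype.sum_of_injective (fun σ : Equiv.Perm (κ × Fin 2) => fun k => (σ (k,0), σ (k,1)))
  · intro σ τ h
    ext1 ⟨k, b⟩
    have := congrFun h k
    simp only [Prod.mk.injEq] at this
    fin_cases b
    · exact this.1
    · exact this.2
  · intro g hg
    by_cases hi : Function.Injective (fun p : κ × Fin 2 => if p.2 = 0 then (g p.1).1 else (g p.1).2)
    · exfalso
      apply hg
      refine ⟨Equiv.ofBijective _ (Finite.injective_iff_bijective.1 hi), ?_⟩
      ext1 k
      simp
    · simp only [Function.Injective, not_forall] at hi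
      obtain ⟨a, b, h, hab⟩ := hi
      rw [Matrix.det_zero_of_column_eq hab, mul_zero]
      intro i
      simp only [Matrix.submatrix_apply, h]
  · intro σ
    have : (fun p : κ × Fin 2 => if p.2 = 0 then ((σ (p.1,0), σ (p.1,1)) : (κ × Fin 2) × (κ × Fin 2)).1 else ((σ (p.1,0), σ (p.1,1)) : (κ × Fin 2) × (κ × Fin 2)).2) = σ := by
      ext1 ⟨k, b⟩
      fin_cases b <;> simp
    rw [this, Matrix.det_permute']
    ring

theorem QQ_block {m : ℕ} {K : Type*} [Field K]
    (A : Fin (m+1) × Fin 2 → Fin (m+1) × Fin 2 → K) (hs : ∀ i j, A i j = - A j i)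
    (h0 : ∀ j, j ≠ (0,1) → A (0,0) j = 0) :
    QQ A = (2 * (m + 1)) * A (0,0) (0,1) *
      QQ (fun i j : Fin m × Fin 2 => A (i.1.succ, i.2) (j.1.succ, j.2)) := by
  set F : Equiv.Perm (Fin (m+1) × Fin 2) → K := fun σ => 
    ((Equiv.Perm.sign σ : ℤ) : K) * ∏ k, A (σ (k,0)) (σ (k,1)) with hF
  have hQ : QQ A = ∑ σ, F σ := rfl
  have pair : ∀ (k : Fin (m+1)) σ, F (σ * (Equiv.prodCongrLeft (fun _ => Equiv.swap 0 k) : Equiv.Perm (Fin (m+1) × Fin 2))) = F σ := by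
    intro k σ
    simp only [hF, Equiv.Perm.sign_mul, Equiv.Perm.sign_prodCongrLeft]
    congr 1
    · simp [Fin.prod_univ_two]
    · exact Fintype.prod_equiv (Equiv.swap 0 k) _ _ (fun l => rfl)
  have flip : ∀ (k : Fin (m+1)) σ, F (σ * Equiv.swap (k,0) (k,1)) = F σ := by
    intro k σ
    simp only [hF, Equiv.Perm.sign_mul]
    rw [Equiv.Perm.sign_swap (by simp), ← Finset.mul_prod_erase _ _ (Finset.mem_univ k),
      ← Finset.mul_prod_erase univ (fun k => A (σ (k,0)) (σ (k,1))) (Finset.mem_univ k)]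
    have : ∀ l ∈ univ.erase k, A ((σ * Equiv.swap (k,0) (k,1) : Equiv.Perm (Fin (m+1) × Fin 2)) (l,0)) ((σ * Equiv.swap (k,0) (k,1) : Equiv.Perm (Fin (m+1) × Fin 2)) (l,1)) = A (σ (l,0)) (σ (l,1)) := by
      intro l hl
      have hl := Finset.ne_of_mem_erase hl
      simp only [Equiv.Perm.mul_apply]
      rw [Equiv.swap_apply_of_ne_of_ne, Equiv.swap_apply_of_ne_of_ne] <;> simp [hl]
    rw [Finset.prod_congr rfl this]
    simp only [Equiv.Perm.mul_apply, Equiv.swap_apply_left, Equiv.swap_apply_right]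
    rw [hs (σ (k,1))]
    push_cast
    ring
  have trans : ∀ p : Fin (m+1) × Fin 2, ∃ τ : Equiv.Perm (Fin (m+1) × Fin 2), τ (0,0) = p ∧ ∀ σ, F (σ * τ) = F σ := by
    rintro ⟨k, b⟩
    fin_cases b
    · exact ⟨_, by simp, pair k⟩
    · refine ⟨Equiv.swap (k,0) (k,1) * (Equiv.prodCongrLeft (fun _ => Equiv.swap 0 k) : Equiv.Perm (Fin (m+1) × Fin 2)), by simp, fun σ => ?_⟩
      rw [← mul_assoc, pair, flip]
  have step : ∀ p, ∑ σ, (if σ p = (0,0) then F σ else 0) = ∑ σ, (if σ (0,0) = (0,0) then F σ else 0) := by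
    intro p
    obtain ⟨τ, h1, h2⟩ := trans p
    refine Fintype.sum_equiv (Equiv.mulRight τ) _ _ fun σ => ?_
    simp [h1, h2]
  have hsum : QQ A = (2 * (m+1)) * ∑ σ, (if σ (0,0) = (0,0) then F σ else 0) := by
    have : ∀ σ, F σ = ∑ p, (if σ p = (0,0) then F σ else 0) := by
      intro σ
      rw [Finset.sum_eq_single (σ.symm (0,0))]
      · simp
      · intro b _ hb
        rw [if_neg]
        rintro h
        exact hb (by rw [← h]; simp)
      · simp
    rw [hQ, Finset.sum_congr rfl (fun σ _ => this σ), Finset.sum_comm, Finset.sum_congr rfl (fun p _ => step p)]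
    rw [Finset.sum_const, Finset.card_univ, nsmul_eq_mul]
    simp only [Fintype.card_prod, Fintype.card_fin]
    push_cast
    ring
  rw [hsum, mul_assoc (2 * ((m:K)+1))]
  congr 1
  unfold QQ
  rw [Finset.mul_sum]
  symm
  let f : Fin m × Fin 2 ≃ {p : Fin (m+1) × Fin 2 // p.1 ≠ 0} := 
    { toFun := fun p => ⟨(p.1.succ, p.2), Fin.succ_ne_zero _⟩
      invFun := fun p => (p.1.1.pred p.2, p.1.2)
      left_inv := fun p => by simp
      right_inv := fun p => by simp }
  have ext_succ : ∀ (e : Equiv.Perm (Fin m × Fin 2)) k b, e.extendDomain f (k.succ, b) = ((e (k,b)).1.succ, (e (k,b)).2) := by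
    intro e k b
    exact Equiv.Perm.extendDomain_apply_image e f (k,b)
  have ext_zero : ∀ (e : Equiv.Perm (Fin m × Fin 2)) b, e.extendDomain f (0, b) = (0,b) := by
    intro e b
    exact Equiv.Perm.extendDomain_apply_not_subtype e f (by simp)
  apply Fintype.sum_of_injective (fun e : Equiv.Perm (Fin m × Fin 2) => e.extendDomain f)
  · exact Equiv.Perm.extendDomainHom_injective f
  · intro σ hσ
    split_ifs with h
    · by_cases h1 : σ (0,1) = (0,1)
      · exfalso
        apply hσ
        have hz : ∀ x : Fin (m+1) × Fin 2, x.1 = 0 → σ x = x := by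
          rintro ⟨k, b⟩ hk
          simp only at hk
          subst hk
          fin_cases b
          · exact h
          · exact h1
        have hp : ∀ x, (σ x).1 ≠ 0 ↔ x.1 ≠ 0 := by
          intro x
          refine not_congr ⟨fun hx => ?_, fun hx => by rw [hz x hx]; exact hx⟩
          have := σ.injective (hz _ hx)
          rwa [this] at hx
        refine ⟨f.permCongr.symm (σ.subtypePerm hp), ?_⟩
        ext1 x
        by_cases hx : x.1 = 0
        · rw [hz x hx]
          exact Equiv.Perm.extendDomain_apply_not_subtype _ f (by simpa using hx)
        · simp only
          rw [Equiv.Perm.extendDomain_apply_subtype _ f hx]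
          simp
      · simp only [hF]
        rw [Finset.prod_eq_zero (Finset.mem_univ 0), mul_zero]
        rw [h, h0 _ h1]
    · rfl
  · intro e
    simp only [hF, Fin.prod_univ_succ, ext_zero, ext_succ, Equiv.Perm.sign_extendDomain, if_true]
    ring


def ss {K : Type*} [Field K] (a b : K) : K := (b - a) / (a + b)

theorem ss_four {K : Type*} [Field K] (a b c d : K) (hab : a + b ≠ 0) (hac : a + c ≠ 0) (had : a + d ≠ 0)
    (hbc : b + c ≠ 0) (hbd : b + d ≠ 0) (hcd : c ≠ d → c + d ≠ 0) (h : b - a ≠ 0) :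
    ss c d - ss a c / ss a b * ss b d - ss a d / ss a b * ss c b
     = (ss a c * ss b c) * ss c d * (ss a d * ss b d) := by
  have hcb : c + b ≠ 0 := by rwa [add_comm]
  unfold ss
  by_cases e : c = d
  · subst e
    simp only [sub_self, zero_div]
    field_simp
    ring
  · have := hcd e
    field_simp
    ring

theorem schur {K : Type*} [Field K] (m : ℕ) : ∀ (y : ℕ → K) 
    (_ : ∀ i j, i ≠ j → y i + y j ≠ 0) (_ : ∀ i j, i ≠ j → y j - y i ≠ 0),
    QQ (fun p q : Fin m × Fin 2 => ss (y (2 * p.1 + p.2)) (y (2 * q.1 + q.2))) =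
      ((2 ^ m * m.factorial : ℕ) : K) * ∏ i ∈ range (2 * m), ∏ j ∈ Ico (i+1) (2*m), ss (y i) (y j) := by
  induction m with
  | zero => intro y _ _; simp [QQ]
  | succ m ih =>
    intro y hp hm
    have ssn : ∀ i j, i ≠ j → ss (y i) (y j) ≠ 0 := fun i j h => div_ne_zero (hm i j h) (hp i j h)
    have sk : ∀ a b : K, ss a b = - ss b a := by
      intro a b
      unfold ss
      rw [add_comm b a, ← neg_div, neg_sub]
    have sz : ∀ a : K, ss a a = 0 := by intro a; simp [ss]
    set A : Matrix (Fin (m+1) × Fin 2) (Fin (m+1) × Fin 2) K := fun p q => ss (y (2 * p.1 + p.2)) (y (2 * q.1 + q.2)) with hA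
    let c : Fin (m+1) × Fin 2 → K := fun p => if p.1 = 0 then 0 else ss (y 0) (y (2 * p.1 + p.2)) / ss (y 0) (y 1)
    let B : Matrix (Fin (m+1) × Fin 2) (Fin (m+1) × Fin 2) K :=
      1 - Matrix.vecMulVec c (Pi.single (0,1) 1)
    have hB : B.det = 1 := by
      have : B = 1 + Matrix.replicateCol Unit (-c) * Matrix.replicateRow Unit (Pi.single (0,1) 1 : Fin (m+1) × Fin 2 → K) := by
        ext i j
        simp [B, Matrix.vecMulVec_apply, Matrix.mul_apply, sub_eq_add_neg]
      rw [this, Matrix.det_one_add_replicateCol_mul_replicateRow]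
      simp [c]
    have hBs : ∀ (i) (g : Fin (m+1) × Fin 2 → K), ∑ k, B i k * g k = g i - c i * g (0,1) := by
      intro i g
      simp [B, Matrix.vecMulVec_apply, sub_mul, Finset.sum_sub_distrib, Matrix.one_apply, Pi.single_apply]
    have key := QQ_congr A B
    rw [hB, one_mul] at key
    have e1 : (fun i j => ∑ p : (Fin (m+1) × Fin 2) × (Fin (m+1) × Fin 2), B i p.1 * A p.1 p.2 * B j p.2) =
        fun i j => A i j - c i * A (0,1) j - c j * A i (0,1) := by
      ext i j
      rw [Fintype.sum_prod_type]
      have : ∀ k, ∑ l, B i k * A k l * B j l = B i k * (A k j - c j * A k (0,1)) := by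
        intro k
        rw [← hBs j (fun l => A k l), Finset.mul_sum]
        exact Finset.sum_congr rfl fun l _ => by ring
      simp only [this]
      rw [hBs i (fun k => A k j - c j * A k (0,1))]
      have : A (0,1) (0,1) = 0 := sz _
      rw [this]
      ring
    rw [e1] at key
    rw [← key, QQ_block]
    rotate_left
    · intro i j
      have := sk (y (2 * i.1 + i.2)) (y (2 * j.1 + j.2))
      have h1 := sk (y (2 * i.1 + i.2)) (y 1)
      have h2 := sk (y (2 * j.1 + j.2)) (y 1)
      simp only [hA]
      simp only [Fin.val_zero, Fin.val_one, mul_zero, zero_add]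
      rw [this, h1, h2]
      ring
    · rintro ⟨k, b⟩ hj
      by_cases hk : k = 0
      · subst hk
        fin_cases b
        · simp [hA, c, sz]
        · simp at hj
      · have := ssn 0 1 (by simp)
        simp [hA, c, hk]
        field_simp
        ring
    · have hd : ∀ i j : ℕ, ss (y (i+2)) (y (j+2)) - ss (y 0) (y (i+2)) / ss (y 0) (y 1) * ss (y 1) (y (j+2))
          - ss (y 0) (y (j+2)) / ss (y 0) (y 1) * ss (y (i+2)) (y 1)
          = (ss (y 0) (y (i+2)) * ss (y 1) (y (i+2))) * ss (y (i+2)) (y (j+2)) * (ss (y 0) (y (j+2)) * ss (y 1) (y (j+2))) := by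
        intro i j
        apply ss_four
        · exact hp _ _ (by omega)
        · exact hp _ _ (by omega)
        · exact hp _ _ (by omega)
        · exact hp _ _ (by omega)
        · exact hp _ _ (by omega)
        · intro h
          exact hp _ _ (fun h' => h (by rw [h']))
        · exact hm _ _ (by omega)
      let d : ℕ → K := fun i => ss (y 0) (y (i+2)) * ss (y 1) (y (i+2))
      have e2 := QQ_congr (κ := Fin m) (fun p q => ss (y (2 * p.1 + p.2 + 2)) (y (2 * q.1 + q.2 + 2)))
        (Matrix.diagonal fun p => d (2 * p.1 + p.2))
      have ih' := ih (fun i => y (i+2)) (fun i j h => hp _ _ (by omega)) (fun i j h => hm _ _ (by omega))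
      rw [ih', Matrix.det_diagonal] at e2
      have e3 : ∀ f : ℕ → K, ∏ p : Fin m × Fin 2, f (2 * p.1 + p.2) = ∏ i ∈ range (2 * m), f i := by
        intro f
        rw [Fintype.prod_prod_type]
        simp only [Fin.prod_univ_two]
        rw [Fin.prod_univ_eq_prod_range (fun k => f (2 * k + (0 : Fin 2)) * f (2 * k + (1 : Fin 2))) m]
        clear * -
        induction m with
        | zero => simp
        | succ m ih => rw [prod_range_succ, ih, show 2 * (m+1) = 2 * m + 1 + 1 by ring, prod_range_succ, prod_range_succ]; simp; ring
      rw [e3 d] at e2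
      have e4 : (fun i j : Fin m × Fin 2 => A (i.1.succ, i.2) (j.1.succ, j.2) - c (i.1.succ, i.2) * A (0,1) (j.1.succ, j.2) - c (j.1.succ, j.2) * A (i.1.succ, i.2) (0,1)) =
         (fun i j => ∑ p : (Fin m × Fin 2) × (Fin m × Fin 2), Matrix.diagonal (fun p : Fin m × Fin 2 => d (2 * p.1 + p.2)) i p.1 * ss (y (2 * p.1.1 + p.1.2 + 2)) (y (2 * p.2.1 + p.2.2 + 2)) * Matrix.diagonal (fun p : Fin m × Fin 2 => d (2 * p.1 + p.2)) j p.2) := by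
        ext i j
        rw [Fintype.sum_prod_type]
        have := hd (2 * i.1 + i.2) (2 * j.1 + j.2)
        have h3 : ∀ i : Fin m × Fin 2, 2 * ((i.1 : ℕ) + 1) + (i.2 : ℕ) = 2 * i.1 + i.2 + 2 := by intro i; ring
        simp only [Matrix.diagonal_apply, ite_mul, mul_ite, zero_mul, mul_zero, Finset.sum_ite_eq, Finset.mem_univ, if_true]
        simp only [hA, c, Fin.succ_ne_zero, if_false, Fin.val_succ, h3, Fin.val_zero, Fin.val_one, mul_zero, zero_add, d]
        exact this
      rw [e4, e2]
      have e5 : A (0,0) (0,1) - c (0,0) * A (0,1) (0,1) - c (0,1) * A (0,0) (0,1) = ss (y 0) (y 1) := by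
        simp [c, hA]
      rw [e5]
      have e6 : ∏ i ∈ range (2 * (m+1)), ∏ j ∈ Ico (i+1) (2*(m+1)), ss (y i) (y j) =
          ss (y 0) (y 1) * (∏ i ∈ range (2*m), d i) * ∏ i ∈ range (2*m), ∏ j ∈ Ico (i+1) (2*m), ss (y (i+2)) (y (j+2)) := by
        rw [show 2 * (m+1) = 2 * m + 1 + 1 by ring, prod_range_succ', prod_range_succ']
        have : ∀ i, ∏ j ∈ Ico (i+1) (2*m), ss (y (i+2)) (y (j+2)) = ∏ j ∈ Ico (i+1+1+1) (2*m+1+1), ss (y (i+1+1)) (y j) := by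
          intro i
          rw [Finset.prod_Ico_add' (fun j => ss (y (i+2)) (y j)) (i+1) (2*m) 2]
        simp only [this]
        have h2 : ∀ a, ∏ j ∈ Ico 2 (2*m+1+1), ss (y a) (y j) = ∏ j ∈ range (2*m), ss (y a) (y (j+2)) := by
          intro a
          rw [Finset.range_eq_Ico, Finset.prod_Ico_add' (fun j => ss (y a) (y j)) 0 (2*m) 2]
        rw [zero_add, Finset.prod_eq_prod_Ico_succ_bot (a := 1) (by omega)]
        rw [one_add_one_eq_two, h2, h2]
        simp only [d, Finset.prod_mul_distrib]
        ring
      rw [e6, Nat.factorial_succ, pow_succ]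
      push_cast
      ring

theorem schur_pf {K : Type*} [Field K] [CharZero K] (m : ℕ) (y : ℕ → K) 
    (hp : ∀ i j, i ≠ j → y i + y j ≠ 0) (hm : ∀ i j, i ≠ j → y j - y i ≠ 0) :
    pfaffian (fun p q : Fin (2 * m) => ss (y p) (y q)) =
      ∏ i ∈ range (2 * m), ∏ j ∈ Ico (i+1) (2*m), ss (y i) (y j) := by
  unfold pfaffian
  rw [div_eq_iff (Nat.cast_ne_zero.2 (by positivity)), mul_comm (∏ i ∈ range (2 * m), _), ← schur m y hp hm]
  unfold QQ
  let e : Fin (2 * m) ≃ Fin m × Fin 2 := 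
    { toFun := fun p => (⟨p / 2, by omega⟩, ⟨p % 2, by omega⟩)
      invFun := fun p => ⟨2 * p.1 + p.2, by omega⟩
      left_inv := fun p => by ext; simp; omega
      right_inv := fun p => by ext <;> simp <;> omega }
  have he : ∀ p : Fin (2*m), 2 * ((e p).1 : ℕ) + (e p).2 = p := by
    intro p
    simp [e]; omega
  refine Fintype.sum_equiv e.permCongr _ _ fun σ => ?_
  rw [Equiv.Perm.sign_permCongr]
  congr 1
  refine Finset.prod_congr rfl fun k _ => ?_
  simp only [Equiv.permCongr_apply, he]
  rfl

theorem xx_ne (p : MvPolynomial ℕ ℚ) (v : ℕ → ℚ) (h : MvPolynomial.eval v p ≠ 0) :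
    algebraMap (MvPolynomial ℕ ℚ) KK p ≠ 0 := by
  intro h0
  rw [FaithfulSMul.algebraMap_eq_zero_iff] at h0
  rw [h0, map_zero] at h
  exact h rfl

theorem xx_add (i j : ℕ) : xx i + xx j ≠ 0 := by
  have := xx_ne (MvPolynomial.X i + MvPolynomial.X j) (fun _ => 1) (by simp)
  simpa [xx] using this

theorem xx_sub (i j : ℕ) (h : i ≠ j) : xx j - xx i ≠ 0 := by
  have := xx_ne (MvPolynomial.X j - MvPolynomial.X i) (fun k => if k = j then 1 else 0) (by simp [h])
  simpa only [xx, map_sub] using this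

theorem xx_zero (i : ℕ) : xx i ≠ 0 := by
  have := xx_ne (MvPolynomial.X i) (fun _ => 1) (by simp)
  simpa [xx] using this

theorem xx_one_sub (i j : ℕ) : 1 - xx i * xx j ≠ 0 := by
  have := xx_ne (1 - MvPolynomial.X i * MvPolynomial.X j) (fun _ => 0) (by simp)
  simpa only [xx, map_sub, map_mul, map_one] using this

theorem xx_one_add (i j : ℕ) : 1 + xx i * xx j ≠ 0 := by
  have := xx_ne (1 + MvPolynomial.X i * MvPolynomial.X j) (fun _ => 0) (by simp)
  simpa only [xx, map_add, map_mul, map_one] using this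

def yy (i : ℕ) : KK := if i = 0 then 0 else xx i / (1 - xx i * xx i)

theorem yy_zero : yy 0 = 0 := if_pos rfl

theorem yy_pos {i : ℕ} (h : i ≠ 0) : yy i = xx i / (1 - xx i * xx i) := if_neg h

theorem yy_ne {i : ℕ} (h : i ≠ 0) : yy i ≠ 0 := by
  rw [yy_pos h]
  exact div_ne_zero (xx_zero i) (xx_one_sub i i)

theorem yy_add' {i j : ℕ} (hi : i ≠ 0) (hj : j ≠ 0) :
    yy i + yy j = ((xx i + xx j) * (1 - xx i * xx j)) / ((1 - xx i * xx i) * (1 - xx j * xx j)) := by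
  have h1 := xx_one_sub i i
  have h2 := xx_one_sub j j
  rw [yy_pos hi, yy_pos hj, div_add_div _ _ h1 h2]
  congr 1
  ring

theorem yy_sub' {i j : ℕ} (hi : i ≠ 0) (hj : j ≠ 0) :
    yy j - yy i = ((xx j - xx i) * (1 + xx i * xx j)) / ((1 - xx i * xx i) * (1 - xx j * xx j)) := by
  have h1 := xx_one_sub i i
  have h2 := xx_one_sub j j
  rw [yy_pos hi, yy_pos hj, div_sub_div _ _ h2 h1, mul_comm (1 - xx i * xx i)]
  congr 1
  ring

theorem yy_add (i j : ℕ) (h : i ≠ j) : yy i + yy j ≠ 0 := by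
  by_cases hi : i = 0
  · subst hi
    rw [yy_zero, zero_add]
    exact yy_ne h.symm
  by_cases hj : j = 0
  · subst hj
    rw [yy_zero, add_zero]
    exact yy_ne h
  rw [yy_add' hi hj]
  exact div_ne_zero (mul_ne_zero (xx_add _ _) (xx_one_sub _ _)) (mul_ne_zero (xx_one_sub _ _) (xx_one_sub _ _))

theorem yy_sub (i j : ℕ) (h : i ≠ j) : yy j - yy i ≠ 0 := by
  by_cases hi : i = 0
  · subst hi
    rw [yy_zero, sub_zero]
    exact yy_ne h.symm
  by_cases hj : j = 0
  · subst hj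
    rw [yy_zero, zero_sub]
    exact neg_ne_zero.2 (yy_ne h)
  rw [yy_sub' hi hj]
  exact div_ne_zero (mul_ne_zero (xx_sub _ _ h) (xx_one_add _ _)) (mul_ne_zero (xx_one_sub _ _) (xx_one_sub _ _))

theorem ss_yy {i j : ℕ} (h : i < j) : ss (yy i) (yy j) =
    if i = 0 then 1 else ((xx j - xx i) * (1 + xx i * xx j)) / ((xx i + xx j) * (1 - xx i * xx j)) := by
  unfold ss
  split_ifs with hi
  · subst hi
    rw [yy_zero, zero_add, sub_zero, div_self (yy_ne h.ne')]
  · have hj : j ≠ 0 := by omega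
    rw [yy_add' hi hj, yy_sub' hi hj, div_div_div_cancel_right₀]
    exact mul_ne_zero (xx_one_sub _ _) (xx_one_sub _ _)

theorem lab_inj (n : ℕ) : ∀ i j, i ≠ j → lab n i ≠ lab n j := by
  intro i j h
  unfold lab
  split_ifs <;> omega

/-- A transformed Schur Pfaffian identity:
`pf_{χ_even(n) ≤ i < j ≤ n}(a_{ij}) = ∏_{1≤i<j≤n} ((x_j - x_i)(1 + x_i x_j))/((x_i + x_j)(1 - x_i x_j))`
where `a_{0j} = 1` and `a_{ij} = ((x_j - x_i)(1 + x_i x_j))/((x_i + x_j)(1 - x_i x_j))`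
for `i ≥ 1`, in `ℚ(x_1,…,x_n)`. -/
theorem stmt12 (n : ℕ) (hn : 0 < n) :
    pfaffian (pfArray n (fun p q => if p = 0 then 1 else ((xx q - xx p) * (1 + xx p * xx q)) / ((xx p + xx q) * (1 - xx p * xx q))))
    = ∏ i ∈ Finset.Icc 1 n, ∏ j ∈ Finset.Ioc i n, ((xx j - xx i) * (1 + xx i * xx j)) / ((xx i + xx j) * (1 - xx i * xx j)) := by
  have h1 : pfArray n (fun p q => if p = 0 then 1 else ((xx q - xx p) * (1 + xx p * xx q)) / ((xx p + xx q) * (1 - xx p * xx q))) = fun p q : Fin (2 * ((n+1)/2)) => ss (yy (lab n p)) (yy (lab n q)) := by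
    ext p q
    unfold pfArray
    by_cases h : lab n p < lab n q
    · rw [if_pos h, ss_yy h]
    · rw [if_neg h]
      by_cases h' : lab n q < lab n p
      · rw [if_pos h']
        beta_reduce
        rw [← ss_yy h']
        unfold ss
        rw [add_comm (yy _), ← neg_div, neg_sub]
      · rw [if_neg h', show lab n p = lab n q by omega]
        simp [ss]
  rw [h1, schur_pf _ (fun i => yy (lab n i)) (fun i j h => yy_add _ _ (lab_inj n i j h))
    (fun i j h => yy_sub _ _ (lab_inj n i j h))]
  have h2 : ∏ i ∈ Finset.Icc 1 n, ∏ j ∈ Finset.Ioc i n, ((xx j - xx i) * (1 + xx i * xx j)) / ((xx i + xx j) * (1 - xx i * xx j)) = ∏ i ∈ Finset.Ico 1 (n+1), ∏ j ∈ Finset.Ico (i+1) (n+1), ss (yy i) (yy j) := by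
    refine Finset.prod_congr (by ext; simp; try omega) fun i hi => ?_
    refine Finset.prod_congr (by ext; simp; try omega) fun j hj => ?_
    rw [Finset.mem_Ico] at hi hj
    rw [ss_yy (by omega), if_neg (by omega)]
  rw [h2]
  by_cases he : Even n
  · have h3 : 2 * ((n+1)/2) = n := by obtain ⟨k, rfl⟩ := he; omega
    have h4 : ∀ i, lab n i = i + 1 := fun i => if_pos he
    simp only [h3, h4]
    rw [Finset.range_eq_Ico, ← Finset.prod_Ico_add' (fun i => ∏ j ∈ Finset.Ico (i+1) (n+1), ss (yy i) (yy j)) 0 n 1]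
    refine Finset.prod_congr rfl fun i _ => ?_
    rw [← Finset.prod_Ico_add' (fun j => ss (yy (i+1)) (yy j)) (i+1) n 1]
  · have h3 : 2 * ((n+1)/2) = n + 1 := by rw [Nat.not_even_iff] at he; omega
    have h4 : ∀ i, lab n i = i := fun i => if_neg he
    simp only [h3, h4]
    rw [Finset.range_eq_Ico, Finset.prod_eq_prod_Ico_succ_bot (by omega)]
    rw [Finset.prod_eq_one, one_mul]
    intro j hj
    rw [Finset.mem_Ico] at hj
    rw [ss_yy (by omega), if_pos rfl]

end
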